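/- Let k ≥ 3, t ≥ 0 and n ≥ 2k+t be integers. Let ℱ ⊆ ([n] choose k+t) and 𝒢 ⊆ ([n] choose k) be cross-intersecting families. If ℱ is (t+1)-intersecting and |ℱ| ≥ 2, then |ℱ| + |𝒢| ≤ C(n,k) − C(n−k−t,k) − C(n−k−t−1,k−1) + 2. -/

import Mathlib

open Finset

open scoped FinsetFamily

section CrossIntersecting

variable {α : Type*} [DecidableEq α]

/-- `F` is a `(t + 1)`-intersecting family of `(k + t)`-subsets of `X`, cross-intersecting with the
family `G` of `k`-subsets of `X`. -/
structure IsCrossPair (k t : ℕ) (X : Finset α) (F G : Finset (Finset α)) : Prop where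
  left_subset : F ⊆ powersetCard (k + t) X
  right_subset : G ⊆ powersetCard k X
  cross : ∀ A ∈ F, ∀ B ∈ G, 1 ≤ #(A ∩ B)
  inter : ∀ A ∈ F, ∀ B ∈ F, t + 1 ≤ #(A ∩ B)

lemma compress_singleton_of_mem {i a : α} {A : Finset α} (hi : i ∉ A) (ha : a ∈ A) :
    UV.compress {i} {a} A = insert i (A.erase a) := by
  have hia : i ≠ a := by rintro rfl; exact hi ha
  rw [UV.compress_of_disjoint_of_le (by simpa using hi) (by simpa using ha)]
  ext x
  simp only [sup_eq_union, mem_sdiff, mem_union, mem_singleton, mem_insert, mem_erase]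
  grind

lemma compress_singleton_of_not {i a : α} {A : Finset α} (h : ¬(i ∉ A ∧ a ∈ A)) :
    UV.compress {i} {a} A = A := by
  rw [UV.compress, if_neg]
  simpa using h

/-- Membership in the `(i, a)`-shift of a family. -/
lemma mem_compression_singleton {i a : α} {F : Finset (Finset α)} {A : Finset α}
    (h : A ∈ 𝓒 {i} {a} F) :
    (A ∈ F ∧ (i ∉ A → a ∈ A → insert i (A.erase a) ∈ F)) ∨
      ∃ B ∈ F, i ∉ B ∧ a ∈ B ∧ A = insert i (B.erase a) := by
  rcases UV.mem_compression.1 h with ⟨h₁, h₂⟩ | ⟨h₁, B, hB, rfl⟩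
  · left
    refine ⟨h₁, fun hi ha => ?_⟩
    rwa [compress_singleton_of_mem hi ha] at h₂
  · right
    by_cases hc : i ∉ B ∧ a ∈ B
    · exact ⟨B, hB, hc.1, hc.2, compress_singleton_of_mem hc.1 hc.2⟩
    · rw [compress_singleton_of_not hc] at h₁
      exact absurd hB h₁

lemma card_inter_shift_left {i a : α} {A B : Finset α} (hiA : i ∉ A) (hiB : i ∉ B) :
    #(insert i (A.erase a) ∩ B) = #(A ∩ insert i (B.erase a)) := by
  congr 1
  grind

lemma card_inter_le_shift {i a : α} {A B : Finset α} (hiB : i ∉ B) (h : a ∈ A → i ∈ A) :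
    #(A ∩ B) ≤ #(A ∩ insert i (B.erase a)) := by
  by_cases ha : a ∈ A
  · have hi := h ha
    calc #(A ∩ B) ≤ #(insert i ((A ∩ B).erase a)) := by
          rw [card_insert_of_notMem (by grind)]
          have := pred_card_le_card_erase (s := A ∩ B) (a := a)
          omega
      _ ≤ _ := card_le_card (by grind)
  · exact card_le_card (by grind)

lemma card_inter_shift_shift {i a : α} {A B : Finset α} (hiA : i ∉ A) (haA : a ∈ A)
    (haB : a ∈ B) :
    #(A ∩ B) ≤ #(insert i (A.erase a) ∩ insert i (B.erase a)) := by
  calc #(A ∩ B) = #(insert i ((A ∩ B).erase a)) := by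
        rw [card_insert_of_notMem (by grind), card_erase_add_one (by grind)]
    _ ≤ _ := card_le_card (by grind)

/-- Shifting two families simultaneously preserves a lower bound on cross-intersection sizes. -/
lemma le_card_inter_of_mem_compression {i a : α} {s : ℕ} {F G : Finset (Finset α)}
    (h : ∀ A ∈ F, ∀ B ∈ G, s ≤ #(A ∩ B)) :
    ∀ A ∈ 𝓒 {i} {a} F, ∀ B ∈ 𝓒 {i} {a} G, s ≤ #(A ∩ B) := by
  intro A hAF B hBG
  rcases mem_compression_singleton hAF with ⟨hA, hA'⟩ | ⟨A, hA, hiA, haA, rfl⟩ <;>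
  rcases mem_compression_singleton hBG with ⟨hB, hB'⟩ | ⟨B, hB, hiB, haB, rfl⟩
  · exact h A hA B hB
  · by_cases hc : a ∈ A → i ∈ A
    · exact (h A hA B hB).trans (card_inter_le_shift hiB hc)
    · push Not at hc
      exact (h _ (hA' hc.2 hc.1) B hB).trans (card_inter_shift_left hc.2 hiB).le
  · by_cases hc : a ∈ B → i ∈ B
    · rw [inter_comm]
      exact (inter_comm A B ▸ h A hA B hB).trans (card_inter_le_shift hiA hc)
    · push Not at hc
      exact (h A hA _ (hB' hc.2 hc.1)).trans (card_inter_shift_left hiA hc.2).ge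
  · exact (h A hA B hB).trans (card_inter_shift_shift hiA haA haB)

lemma compression_subset_powersetCard {i a : α} {r : ℕ} {X : Finset α} (hi : i ∈ X)
    {F : Finset (Finset α)} (h : F ⊆ powersetCard r X) :
    𝓒 {i} {a} F ⊆ powersetCard r X := by
  intro A hA
  rcases mem_compression_singleton hA with ⟨hA, -⟩ | ⟨B, hB, hiB, haB, rfl⟩
  · exact h hA
  · obtain ⟨hBX, hBr⟩ := mem_powersetCard.1 (h hB)
    refine mem_powersetCard.2 ⟨by grind, ?_⟩
    rw [card_insert_of_notMem (by grind), card_erase_add_one haB, hBr]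

lemma card_filter_mem_compression_lt {i a : α} {F : Finset (Finset α)} {A : Finset α}
    (hA : A ∈ F) (hi : i ∉ A) (ha : a ∈ A) (hA' : insert i (A.erase a) ∉ F) :
    #{B ∈ 𝓒 {i} {a} F | a ∈ B} < #{B ∈ F | a ∈ B} := by
  have hia : i ≠ a := by rintro rfl; exact hi ha
  refine card_lt_card ((ssubset_iff_of_subset fun B hB => ?_).2 ⟨A, by simp [hA, ha], ?_⟩)
  · rw [mem_filter] at hB ⊢
    refine ⟨?_, hB.2⟩
    rcases mem_compression_singleton hB.1 with ⟨h, -⟩ | ⟨C, hC, hiC, haC, rfl⟩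
    · exact h
    · grind
  · intro hmem
    rcases mem_compression_singleton (mem_filter.1 hmem).1 with ⟨-, h⟩ | ⟨C, hC, hiC, haC, rfl⟩
    · exact hA' (h hi ha)
    · grind

namespace IsCrossPair

variable {k t : ℕ} {X : Finset α} {F G : Finset (Finset α)} {a : α}

lemma compression (h : IsCrossPair k t X F G) {i : α} (hi : i ∈ X) :
    IsCrossPair k t X (𝓒 {i} {a} F) (𝓒 {i} {a} G) where
  left_subset := compression_subset_powersetCard hi h.left_subset
  right_subset := compression_subset_powersetCard hi h.right_subset
  cross := le_card_inter_of_mem_compression h.cross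
  inter := le_card_inter_of_mem_compression h.inter

lemma card_of_mem_left (h : IsCrossPair k t X F G) {A : Finset α} (hA : A ∈ F) : #A = k + t :=
  (mem_powersetCard.1 (h.left_subset hA)).2

lemma subset_of_mem_left (h : IsCrossPair k t X F G) {A : Finset α} (hA : A ∈ F) : A ⊆ X :=
  (mem_powersetCard.1 (h.left_subset hA)).1

lemma pos (h : IsCrossPair k t X F G) (hF : F.Nonempty) : 0 < k := by
  obtain ⟨A, hA⟩ := hF
  have := h.inter A hA A hA
  rw [inter_self, h.card_of_mem_left hA] at this
  omega

/-- Every cross pair can be replaced by one of the same sizes whose first family is closed under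
exchanging `a` for any other point. -/
lemma exists_shifted (h : IsCrossPair k t X F G) (a : α) :
    ∃ F' G', IsCrossPair k t X F' G' ∧ #F' = #F ∧ #G' = #G ∧
      ∀ i ∈ X, ∀ A ∈ F', a ∈ A → i ∉ A → insert i (A.erase a) ∈ F' := by
  induction hm : #{B ∈ F | a ∈ B} using Nat.strong_induction_on generalizing F G with
  | _ m ih =>
    by_cases hs : ∀ i ∈ X, ∀ A ∈ F, a ∈ A → i ∉ A → insert i (A.erase a) ∈ F
    · exact ⟨F, G, h, rfl, rfl, hs⟩
    · push Not at hs
      obtain ⟨i, hi, A, hA, ha, hiA, hA'⟩ := hs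
      obtain ⟨F', G', h', hF', hG', hs'⟩ :=
        ih _ (hm ▸ card_filter_mem_compression_lt hA hiA ha hA') (h.compression hi) rfl
      exact ⟨F', G', h', by rw [hF', UV.card_compression], by rw [hG', UV.card_compression], hs'⟩

lemma deletion (h : IsCrossPair k t (insert a X) F G) :
    IsCrossPair k t X (F.nonMemberSubfamily a) (G.nonMemberSubfamily a) where
  left_subset A hA := by
    rw [mem_nonMemberSubfamily] at hA
    have := mem_powersetCard.1 (h.left_subset hA.1)
    exact mem_powersetCard.2 ⟨(subset_insert_iff_of_notMem hA.2).1 this.1, this.2⟩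
  right_subset A hA := by
    rw [mem_nonMemberSubfamily] at hA
    have := mem_powersetCard.1 (h.right_subset hA.1)
    exact mem_powersetCard.2 ⟨(subset_insert_iff_of_notMem hA.2).1 this.1, this.2⟩
  cross A hA B hB := h.cross A (mem_nonMemberSubfamily.1 hA).1 B (mem_nonMemberSubfamily.1 hB).1
  inter A hA B hB := h.inter A (mem_nonMemberSubfamily.1 hA).1 B (mem_nonMemberSubfamily.1 hB).1

lemma memberSubfamily_subset_powersetCard {r : ℕ} (h : F ⊆ powersetCard (r + 1) (insert a X)) :
    F.memberSubfamily a ⊆ powersetCard r X := by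
  intro A hA
  rw [mem_memberSubfamily] at hA
  have := mem_powersetCard.1 (h hA.1)
  rw [card_insert_of_notMem hA.2] at this
  exact mem_powersetCard.2
    ⟨(subset_insert_iff_of_notMem hA.2).1 ((subset_insert a A).trans this.1), by omega⟩

/-- If `A ∪ B` does not cover `X` and every set `insert i A` with `i ∈ X \ A` meets `insert a B`
in at least `s` points, then `A` already meets `B` in at least `s` points. -/
lemma le_card_inter_of_exchange {s : ℕ} {A B : Finset α}
    (haA : a ∉ A) (haX : a ∉ X) (hlt : #(A ∪ B) < #X)
    (hex : ∀ i ∈ X, i ∉ A → s ≤ #(insert i A ∩ insert a B)) : s ≤ #(A ∩ B) := by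
  obtain ⟨i, hi, hiAB⟩ := exists_mem_notMem_of_card_lt_card hlt
  refine (hex i hi (by grind)).trans (card_le_card ?_)
  grind

lemma link (h : IsCrossPair (k + 1) t (insert a X) F G) (haX : a ∉ X)
    (hX : 2 * (k + 1) + t ≤ #X)
    (hs : ∀ i ∈ insert a X, ∀ A ∈ F, a ∈ A → i ∉ A → insert i (A.erase a) ∈ F) :
    IsCrossPair k t X (F.memberSubfamily a) (G.memberSubfamily a) := by
  have hl : F.memberSubfamily a ⊆ powersetCard (k + t) X :=
    memberSubfamily_subset_powersetCard (by simpa only [add_right_comm] using h.left_subset)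
  have hr : G.memberSubfamily a ⊆ powersetCard k X :=
    memberSubfamily_subset_powersetCard h.right_subset
  have hex : ∀ A ∈ F.memberSubfamily a, ∀ i ∈ X, i ∉ A → insert i A ∈ F := by
    intro A hA i hi hiA
    rw [mem_memberSubfamily] at hA
    have := hs i (mem_insert_of_mem hi) _ hA.1 (mem_insert_self a A) (by grind)
    rwa [erase_insert hA.2] at this
  refine ⟨hl, hr, fun A hA B hB => ?_, fun A hA B hB => ?_⟩
  · have hAc := (mem_powersetCard.1 (hl hA)).2
    have hBc := (mem_powersetCard.1 (hr hB)).2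
    have hex := hex A hA
    rw [mem_memberSubfamily] at hA hB
    have := card_union_le A B
    exact le_card_inter_of_exchange hA.2 haX (by omega)
      fun i hi hiA => h.cross _ (hex i hi hiA) _ hB.1
  · have hAc := (mem_powersetCard.1 (hl hA)).2
    have hBc := (mem_powersetCard.1 (hl hB)).2
    have hex := hex A hA
    rw [mem_memberSubfamily] at hA hB
    have hAB := h.inter _ hA.1 _ hB.1
    rw [← insert_inter_distrib, card_insert_of_notMem (by grind)] at hAB
    have := card_union_add_card_inter A B
    exact le_card_inter_of_exchange hA.2 haX (by omega)
      fun i hi hiA => h.inter _ (hex i hi hiA) _ hB.1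

/-- On a ground set of the smallest size, complements of members of `F` avoid `G`. -/
lemma card_add_card_le_choose (h : IsCrossPair k t X F G) (hX : #X = 2 * k + t) :
    #F + #G ≤ (#X).choose k := by
  have hinj : Set.InjOn (fun A => X \ A) (F : Set (Finset α)) := by
    intro A hA B hB hAB
    rw [← _root_.sdiff_sdiff_eq_self (h.subset_of_mem_left hA),
      ← _root_.sdiff_sdiff_eq_self (h.subset_of_mem_left hB)]
    exact congrArg (X \ ·) hAB
  rw [← card_image_of_injOn hinj, ← card_union_of_disjoint, ← card_powersetCard]
  · refine card_le_card (union_subset ?_ h.right_subset)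
    intro C hC
    obtain ⟨A, hA, rfl⟩ := mem_image.1 hC
    refine mem_powersetCard.2 ⟨sdiff_subset, ?_⟩
    rw [card_sdiff_of_subset (h.subset_of_mem_left hA), h.card_of_mem_left hA]
    omega
  · rw [disjoint_left]
    intro C hC hCG
    obtain ⟨A, hA, rfl⟩ := mem_image.1 hC
    simpa using h.cross A hA _ hCG

end IsCrossPair

lemma card_add_choose_le_of_inter_nonempty {k : ℕ} {X A : Finset α} {G : Finset (Finset α)}
    (hG : G ⊆ powersetCard k X) (hA : A ⊆ X) (h : ∀ B ∈ G, (A ∩ B).Nonempty) :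
    #G + (#X - #A).choose k ≤ (#X).choose k := by
  rw [← card_sdiff_of_subset hA, ← card_powersetCard, ← card_powersetCard,
    ← card_union_of_disjoint]
  · exact card_le_card (union_subset hG (powersetCard_mono sdiff_subset))
  · rw [disjoint_left]
    intro B hB hB'
    obtain ⟨x, hx⟩ := h B hB
    have := (mem_powersetCard.1 hB').1
    grind

lemma card_add_choose_add_choose_le_of_inter_nonempty {k r : ℕ} {X A B : Finset α}
    {G : Finset (Finset α)} (hG : G ⊆ powersetCard (k + 1) X)
    (hA : A ⊆ X) (hB : B ⊆ X) (hAr : #A = r) (hBr : #B = r) (hAB : A ≠ B)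
    (hGA : ∀ C ∈ G, (A ∩ C).Nonempty) (hGB : ∀ C ∈ G, (B ∩ C).Nonempty) :
    #G + (#X - r).choose (k + 1) + (#X - r - 1).choose k ≤ (#X).choose (k + 1) := by
  obtain ⟨x, hxA, hxB⟩ : ∃ x ∈ A, x ∉ B := by
    by_contra! hsub
    exact hAB (eq_of_subset_of_card_le hsub (by omega))
  set P := powersetCard k ((X \ B).erase x) with hP
  have hxP : ∀ S ∈ P, x ∉ S := fun S hS hx => by
    have := (mem_powersetCard.1 hS).1 hx
    simp at this
  have hPX : ∀ S ∈ P, S ⊆ X \ B := fun S hS =>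
    (mem_powersetCard.1 hS).1.trans (erase_subset _ _)
  have hcard : #(P.image (insert x)) = (#X - r - 1).choose k := by
    rw [card_image_of_injOn, hP, card_powersetCard, card_erase_of_mem (by grind),
      card_sdiff_of_subset hB, hBr]
    intro S hS T hT hST
    rw [← erase_insert (hxP S hS), ← erase_insert (hxP T hT)]
    exact congrArg (·.erase x) hST
  have hdis : Disjoint (G ∪ powersetCard (k + 1) (X \ A)) (P.image (insert x)) := by
    rw [disjoint_left]
    intro C hC hC'
    obtain ⟨S, hS, rfl⟩ := mem_image.1 hC'
    rcases mem_union.1 hC with hC | hC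
    · obtain ⟨y, hy⟩ := hGB _ hC
      have := hPX S hS
      grind
    · have := (mem_powersetCard.1 hC).1 (mem_insert_self x S)
      grind
  have hdis' : Disjoint G (powersetCard (k + 1) (X \ A)) := by
    rw [disjoint_left]
    intro C hC hC'
    obtain ⟨y, hy⟩ := hGA C hC
    have := (mem_powersetCard.1 hC').1
    grind
  rw [← hcard, ← hAr, ← card_sdiff_of_subset hA, ← card_powersetCard, ← card_powersetCard,
    ← card_union_of_disjoint hdis', ← card_union_of_disjoint hdis]
  refine card_le_card (union_subset (union_subset hG (powersetCard_mono sdiff_subset)) ?_)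
  intro C hC
  obtain ⟨S, hS, rfl⟩ := mem_image.1 hC
  have := hPX S hS
  refine mem_powersetCard.2 ⟨by grind, ?_⟩
  rw [card_insert_of_notMem (hxP S hS), (mem_powersetCard.1 hS).2]

namespace IsCrossPair

variable {k t : ℕ} {X : Finset α} {F G : Finset (Finset α)} {a : α}

lemma inter_nonempty_of_mem_memberSubfamily (h : IsCrossPair k t X F G) {A B : Finset α}
    (hA : A ∈ F.nonMemberSubfamily a) (hB : B ∈ G.memberSubfamily a) : (A ∩ B).Nonempty := by
  rw [mem_nonMemberSubfamily] at hA
  rw [mem_memberSubfamily] at hB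
  have := h.cross A hA.1 _ hB.1
  rwa [inter_insert_of_notMem hA.2, one_le_card] at this

lemma nonMemberSubfamily_nontrivial (h : IsCrossPair k t (insert a X) F G) (haX : a ∉ X)
    (hX : k + t < #X)
    (hs : ∀ i ∈ insert a X, ∀ A ∈ F, a ∈ A → i ∉ A → insert i (A.erase a) ∈ F)
    {A : Finset α} (hA : A ∈ F) (ha : a ∈ A) : 2 ≤ #(F.nonMemberSubfamily a) := by
  have hc : 1 < #(insert a X \ A) := by
    rw [card_sdiff_of_subset (h.subset_of_mem_left hA), h.card_of_mem_left hA,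
      card_insert_of_notMem haX]
    omega
  obtain ⟨i, hi, j, hj, hij⟩ := one_lt_card.1 hc
  rw [mem_sdiff] at hi hj
  refine one_lt_card.2 ⟨insert i (A.erase a), ?_, insert j (A.erase a), ?_, by grind⟩
  · rw [mem_nonMemberSubfamily]
    exact ⟨hs i hi.1 A hA ha hi.2, by grind⟩
  · rw [mem_nonMemberSubfamily]
    exact ⟨hs j hj.1 A hA ha hj.2, by grind⟩

lemma nonMemberSubfamily_eq_or (h : IsCrossPair k t (insert a X) F G) (haX : a ∉ X)
    (hX : k + t < #X)
    (hs : ∀ i ∈ insert a X, ∀ A ∈ F, a ∈ A → i ∉ A → insert i (A.erase a) ∈ F) :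
    F.nonMemberSubfamily a = F ∨ 2 ≤ #(F.nonMemberSubfamily a) := by
  by_cases hF : ∃ A ∈ F, a ∈ A
  · obtain ⟨A, hA, ha⟩ := hF
    exact .inr (h.nonMemberSubfamily_nontrivial haX hX hs hA ha)
  · push Not at hF
    exact .inl (filter_true_of_mem hF)

/-- The Hilton–Milner type bound for a nonempty first family. -/
theorem card_add_card_add_choose_le (h : IsCrossPair k t X F G) (hX : 2 * k + t ≤ #X)
    (hF : F.Nonempty) : #F + #G + (#X - (k + t)).choose k ≤ (#X).choose k + 1 := by
  induction X using Finset.induction_on generalizing k F G with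
  | empty =>
    have := h.pos hF
    simp at hX
    omega
  | insert a Y haY ih =>
    have hk := h.pos hF
    obtain ⟨k, rfl⟩ := Nat.exists_eq_succ_of_ne_zero hk.ne'
    rw [Nat.succ_eq_add_one] at *
    have hcard := card_insert_of_notMem haY
    rcases hX.eq_or_lt with hX | hX
    · have := h.card_add_card_le_choose hX.symm
      rw [show #(insert a Y) - (k + 1 + t) = k + 1 by omega, Nat.choose_self]
      omega
    obtain ⟨F', G', h', hF', hG', hs⟩ := h.exists_shifted a
    rw [← hF', ← hG']
    have hFne : F'.Nonempty := by rw [← card_pos, hF']; exact hF.card_pos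
    have hdne : (F'.nonMemberSubfamily a).Nonempty := by
      rcases h'.nonMemberSubfamily_eq_or haY (by omega) hs with h₁ | h₁
      · rwa [h₁]
      · exact card_pos.1 (by omega)
    have hdel := ih h'.deletion (by omega) hdne
    have hlink := h'.link haY (by omega) hs
    obtain ⟨m, hm⟩ : ∃ m, #Y - (k + 1 + t) = m := ⟨_, rfl⟩
    have key : #(F'.memberSubfamily a) + #(G'.memberSubfamily a) + m.choose k
        ≤ (#Y).choose k := by
      rcases (F'.memberSubfamily a).eq_empty_or_nonempty with he | hne
      · obtain ⟨A, hA⟩ := hdne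
        have := card_add_choose_le_of_inter_nonempty hlink.right_subset
          (h'.deletion.subset_of_mem_left hA)
          fun B hB => h'.inter_nonempty_of_mem_memberSubfamily hA hB
        rw [h'.deletion.card_of_mem_left hA, hm] at this
        simpa [he] using this
      · have hk' := hlink.pos hne
        have := ih hlink (by omega) hne
        obtain ⟨k, rfl⟩ := Nat.exists_eq_succ_of_ne_zero hk'.ne'
        rw [Nat.succ_eq_add_one] at *
        rw [show #Y - (k + 1 + t) = m + 1 by omega, Nat.choose_succ_succ' m k] at this
        have : 0 < m.choose k := Nat.choose_pos (by omega)
        omega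
    have h₁ := card_memberSubfamily_add_card_nonMemberSubfamily a F'
    have h₂ := card_memberSubfamily_add_card_nonMemberSubfamily a G'
    rw [hm] at hdel
    rw [hcard, show #Y + 1 - (k + 1 + t) = m + 1 by omega, Nat.choose_succ_succ',
      Nat.choose_succ_succ']
    omega

/-- The bound for a first family with at least two members. -/
theorem card_add_card_add_choose_add_choose_le (h : IsCrossPair (k + 3) t X F G)
    (hX : 2 * (k + 3) + t ≤ #X) (hF : 2 ≤ #F) :
    #F + #G + (#X - (k + 3 + t)).choose (k + 3) + (#X - (k + 3 + t) - 1).choose (k + 2)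
      ≤ (#X).choose (k + 3) + 2 := by
  induction X using Finset.induction_on generalizing F G with
  | empty => simp at hX
  | insert a Y haY ih =>
    have hcard := card_insert_of_notMem haY
    rcases hX.eq_or_lt with hX | hX
    · have := h.card_add_card_le_choose hX.symm
      rw [show #(insert a Y) - (k + 3 + t) = k + 3 by omega, Nat.choose_self,
        show k + 3 - 1 = k + 2 by omega, Nat.choose_self]
      omega
    obtain ⟨F', G', h', hF', hG', hs⟩ := h.exists_shifted a
    rw [← hF', ← hG']
    have hd : 2 ≤ #(F'.nonMemberSubfamily a) := by
      rcases h'.nonMemberSubfamily_eq_or haY (by omega) hs with h₁ | h₁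
      · rwa [h₁, hF']
      · exact h₁
    have hdel := ih h'.deletion (by omega) hd
    have hlink := h'.link haY (by omega) hs
    obtain ⟨m, hm⟩ : ∃ m, #Y - (k + 3 + t) = m + 1 := ⟨#Y - (k + 3 + t) - 1, by omega⟩
    have key : #(F'.memberSubfamily a) + #(G'.memberSubfamily a) + (m + 1).choose (k + 2)
        + m.choose (k + 1) ≤ (#Y).choose (k + 2) := by
      rcases (F'.memberSubfamily a).eq_empty_or_nonempty with he | hne
      · obtain ⟨A, hA, B, hB, hAB⟩ := one_lt_card.1 hd
        have := card_add_choose_add_choose_le_of_inter_nonempty hlink.right_subset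
          (h'.deletion.subset_of_mem_left hA) (h'.deletion.subset_of_mem_left hB)
          (h'.deletion.card_of_mem_left hA) (h'.deletion.card_of_mem_left hB) hAB
          (fun C hC => h'.inter_nonempty_of_mem_memberSubfamily hA hC)
          (fun C hC => h'.inter_nonempty_of_mem_memberSubfamily hB hC)
        rw [hm, Nat.add_sub_cancel] at this
        simpa [he] using this
      · have := hlink.card_add_card_add_choose_le (by omega) hne
        rw [show #Y - (k + 2 + t) = m + 1 + 1 by omega, Nat.choose_succ_succ' (m + 1) (k + 1)] at this
        have := Nat.choose_succ_succ' m k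
        have : 0 < m.choose k := Nat.choose_pos (by omega)
        norm_num only [add_assoc] at *
        omega
    have h₁ := card_memberSubfamily_add_card_nonMemberSubfamily a F'
    have h₂ := card_memberSubfamily_add_card_nonMemberSubfamily a G'
    rw [hm, Nat.add_sub_cancel] at hdel
    rw [hcard, show #Y + 1 - (k + 3 + t) = m + 1 + 1 by omega, Nat.add_sub_cancel,
      Nat.choose_succ_succ' (#Y) (k + 2), Nat.choose_succ_succ' (m + 1) (k + 2)]
    have := Nat.choose_succ_succ' m (k + 1)
    norm_num only [add_assoc] at *
    omega

end IsCrossPair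

end CrossIntersecting

/-- Wu (2023): if `ℱ ⊆ ([n] choose k+t)` and `𝒢 ⊆ ([n] choose k)` are
cross-intersecting, `ℱ` is `(t+1)`-intersecting and `|ℱ| ≥ 2`, then
`|ℱ| + |𝒢| ≤ C(n,k) − C(n−k−t,k) − C(n−k−t−1,k−1) + 2`. -/
theorem stmt_2 (k t n : ℕ) (hk : 3 ≤ k) (hn : 2 * k + t ≤ n)
    (F G : Finset (Finset ℕ))
    (hF : F ⊆ powersetCard (k + t) (Icc 1 n))
    (hG : G ⊆ powersetCard k (Icc 1 n))
    (hcross : ∀ A ∈ F, ∀ B ∈ G, (A ∩ B).Nonempty)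
    (hint : ∀ A ∈ F, ∀ B ∈ F, t + 1 ≤ (A ∩ B).card)
    (hF2 : 2 ≤ F.card) :
    (F.card : ℤ) + G.card ≤
      (n.choose k : ℤ) - (n - k - t).choose k - (n - k - t - 1).choose (k - 1) + 2 := by
  obtain ⟨k, rfl⟩ := Nat.exists_eq_add_of_le' hk
  have h : IsCrossPair (k + 3) t (Icc 1 n) F G :=
    ⟨hF, hG, fun A hA B hB => one_le_card.2 (hcross A hA B hB), hint⟩
  have hcard : #(Icc 1 n) = n := by simp
  have := h.card_add_card_add_choose_add_choose_le (by omega) hF2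
  rw [hcard, ← Nat.sub_sub] at this
  rw [show k + 3 - 1 = k + 2 by omega]
  omega
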